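/- arXiv:1905.04410 — 11 statements merged into one kernel-verified Lean document; each statement's English description precedes it below -/
import Mathlib

section
/- Let A : ℝ³ → ℝ³ be of class C² and let B = ∇×A be its curl. Suppose x̃, ṽ : ℝ × ℝ → ℝ³ are of class C², are 2π-periodic in the loop variable θ, and solve the loop-space Lorentz equations with a continuous frequency Ω : ℝ → ℝ. Then the normalized loop action t ↦ (1/2π)·∫₀^{2π} ((1/ε)·A(x̃(θ,t)) + ṽ(θ,t)) · ∂_θ x̃(θ,t) dθ is constant in t. -/
open Real

noncomputable section

abbrev E3 : Type := EuclideanSpace ℝ (Fin 3)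

/-- The cross product on `ℝ³`. -/
def cross (u v : E3) : E3 :=
  (WithLp.equiv 2 (Fin 3 → ℝ)).symm
    ![u 1 * v 2 - u 2 * v 1, u 2 * v 0 - u 0 * v 2, u 0 * v 1 - u 1 * v 0]

/-- The dot product on `ℝ³`. -/
def dot (u v : E3) : ℝ := u 0 * v 0 + u 1 * v 1 + u 2 * v 2

/-- The curl of a vector field on `ℝ³`, defined componentwise from the Fréchet derivative. -/
def curl (A : E3 → E3) (x : E3) : E3 :=
  (WithLp.equiv 2 (Fin 3 → ℝ)).symm
    ![fderiv ℝ A x (EuclideanSpace.single 1 1) 2 - fderiv ℝ A x (EuclideanSpace.single 2 1) 1,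
      fderiv ℝ A x (EuclideanSpace.single 2 1) 0 - fderiv ℝ A x (EuclideanSpace.single 0 1) 2,
      fderiv ℝ A x (EuclideanSpace.single 0 1) 1 - fderiv ℝ A x (EuclideanSpace.single 1 1) 0]

theorem dot_eq_inner (u v : E3) : dot u v = inner ℝ u v := by
  simp [dot, PiLp.inner_apply, Fin.sum_univ_three, mul_comm]

/-- The exterior derivative of the one-form `A`, written with the curl. -/
theorem dot_fderiv_sub_dot_fderiv (A : E3 → E3) (x u w : E3) :
    dot (fderiv ℝ A x u) w - dot (fderiv ℝ A x w) u = dot (cross (curl A x) u) w := by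
  have expand (z : E3) : fderiv ℝ A x z = z 0 • fderiv ℝ A x (EuclideanSpace.single 0 1)
      + z 1 • fderiv ℝ A x (EuclideanSpace.single 1 1)
      + z 2 • fderiv ℝ A x (EuclideanSpace.single 2 1) := by
    simp only [← map_smul, ← map_add]
    congr 1
    ext i
    fin_cases i <;> simp
  rw [expand u, expand w]
  simp [dot, cross, curl]
  ring

/-- The pointwise identity behind conservation of the loop action: the `A`-terms and the Lorentz
force cancel, and only the kinetic term remains. -/
theorem loop_action_pointwise {c ω : ℝ} {A : E3 → E3} {x v xθ xτ vθ vτ : E3}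
    (h₁ : xτ + ω • xθ = v) (h₂ : vτ + ω • vθ = c • cross v (curl A x)) :
    dot (c • fderiv ℝ A x xτ + vτ) xθ = dot (c • fderiv ℝ A x xθ + vθ) xτ - dot v vθ := by
  have hcurl := dot_fderiv_sub_dot_fderiv A x v xθ
  obtain rfl : xτ = v - ω • xθ := eq_sub_of_add_eq h₁
  obtain rfl : vτ = c • cross v (curl A x) - ω • vθ := eq_sub_of_add_eq h₂
  rw [map_sub, map_smul]
  simp [dot, cross] at hcurl ⊢
  linear_combination c * hcurl

/-- If `∂_t F = ∂_θ G` and `G` takes equal values at the ends `a`, `b` of the `θ`-interval, then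
`∫ F dθ` does not depend on `t`. -/
theorem integral_eq_of_fderiv_eq {F G : ℝ × ℝ → ℝ} (hF : ContDiff ℝ 1 F) (hG : ContDiff ℝ 1 G)
    (h : ∀ p, fderiv ℝ F p (0, 1) = fderiv ℝ G p (1, 0)) {a b : ℝ}
    (hab : ∀ t, G (b, t) = G (a, t)) (t₁ t₂ : ℝ) :
    ∫ θ in a..b, F (θ, t₁) = ∫ θ in a..b, F (θ, t₂) := by
  have hdiv : (fun p => (-fderiv ℝ G p) (1, 0) + fderiv ℝ F p (0, 1)) = fun _ => (0 : ℝ) := by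
    ext p
    simp [h p]
  have key := MeasureTheory.integral2_divergence_prod_of_hasFDerivAt
    (fun p => -G p) F (fun p => -fderiv ℝ G p) (fderiv ℝ F) a t₁ b t₂
    hG.continuous.neg.continuousOn hF.continuous.continuousOn
    (fun p _ => (hG.differentiable one_ne_zero p).hasFDerivAt.neg)
    (fun p _ => (hF.differentiable one_ne_zero p).hasFDerivAt)
    (by rw [hdiv]; exact MeasureTheory.integrableOn_zero)
  simp only [neg_apply, h, neg_add_cancel, hab,
    intervalIntegral.integral_zero] at key
  linarith

theorem fderiv_dot_apply {U W : ℝ × ℝ → E3} {p : ℝ × ℝ} (hU : DifferentiableAt ℝ U p)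
    (hW : DifferentiableAt ℝ W p) (h : ℝ × ℝ) :
    fderiv ℝ (fun q => dot (U q) (W q)) p h
      = dot (U p) (fderiv ℝ W p h) + dot (fderiv ℝ U p h) (W p) := by
  simp only [dot_eq_inner]
  exact fderiv_inner_apply ℝ hU hW h

theorem ContDiff.dot {n : WithTop ℕ∞} {U W : ℝ × ℝ → E3} (hU : ContDiff ℝ n U)
    (hW : ContDiff ℝ n W) : ContDiff ℝ n (fun q => dot (U q) (W q)) := by
  simp only [dot_eq_inner]
  exact hU.inner ℝ hW

theorem deriv_fst_slice {U : ℝ × ℝ → E3} (hU : Differentiable ℝ U) (θ t : ℝ) :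
    deriv (fun ϑ => U (ϑ, t)) θ = fderiv ℝ U (θ, t) (1, 0) :=
  ((hU (θ, t)).hasFDerivAt.comp_hasDerivAt θ
    ((hasDerivAt_id θ).prodMk (hasDerivAt_const θ t))).deriv

theorem deriv_snd_slice {U : ℝ × ℝ → E3} (hU : Differentiable ℝ U) (θ t : ℝ) :
    deriv (fun s => U (θ, s)) t = fderiv ℝ U (θ, t) (0, 1) :=
  ((hU (θ, t)).hasFDerivAt.comp_hasDerivAt t
    ((hasDerivAt_const t θ).prodMk (hasDerivAt_id t))).deriv

/-- Mixed partial derivatives of a `C²` map commute. -/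
theorem fderiv_fderiv_apply_comm {U : ℝ × ℝ → E3} (hU : ContDiff ℝ 2 U) (p h k : ℝ × ℝ) :
    fderiv ℝ (fun q => fderiv ℝ U q h) p k = fderiv ℝ (fun q => fderiv ℝ U q k) p h := by
  have hd : DifferentiableAt ℝ (fderiv ℝ U) p :=
    (hU.fderiv_right (m := 1) (by norm_num)).differentiable one_ne_zero p
  have hsymm : IsSymmSndFDerivAt ℝ U p := hU.contDiffAt.isSymmSndFDerivAt (by simp)
  rw [fderiv_clm_apply hd (differentiableAt_const h), fderiv_clm_apply hd (differentiableAt_const k)]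
  simpa using hsymm k h

/-- For `C²` loop-space Lorentz dynamics with `B = ∇×A` and continuous
frequency `Ω`, the normalized loop action
`t ↦ (1/2π)·∫₀^{2π} ((1/ε)·A(xt(θ,t)) + vt(θ,t)) · ∂_θ xt(θ,t) dθ` is constant in time. -/
theorem loop_action_constant
    (ε : ℝ) (hε : ε ≠ 0)
    (A : E3 → E3) (hA : ContDiff ℝ 2 A)
    (xt vt : ℝ → ℝ → E3)
    (hx : ContDiff ℝ 2 (fun p : ℝ × ℝ => xt p.1 p.2))
    (hv : ContDiff ℝ 2 (fun p : ℝ × ℝ => vt p.1 p.2))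
    (hxper : ∀ θ t, xt (θ + 2 * π) t = xt θ t)
    (hvper : ∀ θ t, vt (θ + 2 * π) t = vt θ t)
    (Ω : ℝ → ℝ) (hΩ : Continuous Ω)
    (heq1 : ∀ θ t, deriv (fun s => xt θ s) t + Ω t • deriv (fun ϑ => xt ϑ t) θ = vt θ t)
    (heq2 : ∀ θ t, deriv (fun s => vt θ s) t + Ω t • deriv (fun ϑ => vt ϑ t) θ
      = (1 / ε) • cross (vt θ t) (curl A (xt θ t))) :
    ∀ t₁ t₂ : ℝ,
      (2 * π)⁻¹ * ∫ θ in (0:ℝ)..(2 * π),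
        dot ((1 / ε) • A (xt θ t₁) + vt θ t₁) (deriv (fun ϑ => xt ϑ t₁) θ)
      = (2 * π)⁻¹ * ∫ θ in (0:ℝ)..(2 * π),
        dot ((1 / ε) • A (xt θ t₂) + vt θ t₂) (deriv (fun ϑ => xt ϑ t₂) θ) := by
  intro t₁ t₂
  set X : ℝ × ℝ → E3 := fun p => xt p.1 p.2 with hX
  set V : ℝ × ℝ → E3 := fun p => vt p.1 p.2 with hV
  have hXd : Differentiable ℝ X := hx.differentiable two_ne_zero
  have hVd : Differentiable ℝ V := hv.differentiable two_ne_zero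
  have hV1 : ContDiff ℝ 1 V := hv.of_le one_le_two
  have hXpart (h : ℝ × ℝ) : ContDiff ℝ 1 (fun p => fderiv ℝ X p h) :=
    (hx.fderiv_right (by norm_num)).clm_apply contDiff_const
  set P : ℝ × ℝ → E3 := fun p => (1 / ε) • A (X p) + V p with hP
  have hP1 : ContDiff ℝ 1 P := (((hA.comp hx).of_le one_le_two).const_smul (1 / ε)).add hV1
  have hPd : Differentiable ℝ P := hP1.differentiable one_ne_zero
  have hPfderiv (p h : ℝ × ℝ) : fderiv ℝ P p h
      = (1 / ε) • fderiv ℝ A (X p) (fderiv ℝ X p h) + fderiv ℝ V p h := by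
    have hAX := (hA.differentiable two_ne_zero (X p)).hasFDerivAt.comp p (hXd p).hasFDerivAt
    have hsum := (hAX.const_smul (1 / ε)).add (hVd p).hasFDerivAt
    exact congrArg (fun L : ℝ × ℝ →L[ℝ] E3 => L h) hsum.fderiv
  have hXθ (θ t : ℝ) : deriv (fun ϑ => xt ϑ t) θ = fderiv ℝ X (θ, t) (1, 0) :=
    deriv_fst_slice hXd θ t
  have hXτ (θ t : ℝ) : deriv (fun s => xt θ s) t = fderiv ℝ X (θ, t) (0, 1) :=
    deriv_snd_slice hXd θ t
  have hVθ (θ t : ℝ) : deriv (fun ϑ => vt ϑ t) θ = fderiv ℝ V (θ, t) (1, 0) :=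
    deriv_fst_slice hVd θ t
  have hVτ (θ t : ℝ) : deriv (fun s => vt θ s) t = fderiv ℝ V (θ, t) (0, 1) :=
    deriv_snd_slice hVd θ t
  have hF : ContDiff ℝ 1 (fun p => dot (P p) (fderiv ℝ X p (1, 0))) := hP1.dot (hXpart _)
  have hPXτ : ContDiff ℝ 1 (fun p => dot (P p) (fderiv ℝ X p (0, 1))) := hP1.dot (hXpart _)
  have hVV : ContDiff ℝ 1 (fun p => dot (V p) (V p) / 2) := (hV1.dot hV1).div_const 2
  have hG := hPXτ.sub hVV
  have hFG (p : ℝ × ℝ) : fderiv ℝ (fun p => dot (P p) (fderiv ℝ X p (1, 0))) p (0, 1)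
      = fderiv ℝ (fun p => dot (P p) (fderiv ℝ X p (0, 1)) - dot (V p) (V p) / 2) p (1, 0) := by
    have hXdd (h : ℝ × ℝ) := (hXpart h).differentiable one_ne_zero p
    have hlorentz := loop_action_pointwise
      (by simpa only [hXθ, hXτ] using heq1 p.1 p.2) (by simpa only [hVθ, hVτ] using heq2 p.1 p.2)
    have hkin : fderiv ℝ (fun p => dot (V p) (V p) / 2) p (1, 0)
        = dot (V p) (fderiv ℝ V p (1, 0)) := by
      simp only [div_eq_inv_mul]
      rw [fderiv_const_mul ((hV1.dot hV1).differentiable one_ne_zero p),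
        smul_apply, fderiv_dot_apply (hVd p) (hVd p)]
      simp only [dot, smul_eq_mul]
      ring
    rw [fderiv_fun_sub (hPXτ.differentiable one_ne_zero p) (hVV.differentiable one_ne_zero p),
      sub_apply, hkin, fderiv_dot_apply (hPd p) (hXdd _),
      fderiv_dot_apply (hPd p) (hXdd _), fderiv_fderiv_apply_comm hx p (1, 0) (0, 1),
      hPfderiv, hPfderiv]
    linear_combination hlorentz
  have hper (t : ℝ) : (fun p => dot (P p) (fderiv ℝ X p (0, 1)) - dot (V p) (V p) / 2) (2 * π, t)
      = (fun p => dot (P p) (fderiv ℝ X p (0, 1)) - dot (V p) (V p) / 2) (0, t) := by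
    have hx0 (s : ℝ) : xt (2 * π) s = xt 0 s := by simpa using hxper 0 s
    have hv0 (s : ℝ) : vt (2 * π) s = vt 0 s := by simpa using hvper 0 s
    have hXτ0 : fderiv ℝ X (2 * π, t) (0, 1) = fderiv ℝ X (0, t) (0, 1) := by
      simp only [← hXτ, hx0]
    simp only [hXτ0]
    simp only [hP, hX, hV, hx0, hv0]
  simp only [hXθ]
  exact congrArg ((2 * π)⁻¹ * ·) (integral_eq_of_fderiv_eq hF hG hFG hper t₁ t₂)

end
end

section
/- Let B : ℝ³ → ℝ³ be continuous. Suppose x̃, ṽ : ℝ × ℝ → ℝ³ are of class C¹, are 2π-periodic in the loop variable θ, and solve the loop-space Lorentz equations with a continuous frequency Ω : ℝ → ℝ. Then the loop energy t ↦ (1/2π)·∫₀^{2π} (1/2)·‖ṽ(θ,t)‖² dθ is constant in t. -/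
open Real

noncomputable section

lemma inner_self_cross (u w : E3) : inner ℝ u (cross u w) = 0 := by
  simp [cross, PiLp.inner_apply, Fin.sum_univ_three]
  ring

lemma hasDerivAt_fst_slice {E : Type*} [NormedAddCommGroup E] [NormedSpace ℝ E]
    {f : ℝ × ℝ → E} {θ t : ℝ} (hf : DifferentiableAt ℝ f (θ, t)) :
    HasDerivAt (fun ϑ => f (ϑ, t)) (fderiv ℝ f (θ, t) (1, 0)) θ :=
  hf.hasFDerivAt.comp_hasDerivAt θ ((hasDerivAt_id θ).prodMk (hasDerivAt_const θ t))

lemma hasDerivAt_snd_slice {E : Type*} [NormedAddCommGroup E] [NormedSpace ℝ E]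
    {f : ℝ × ℝ → E} {θ t : ℝ} (hf : DifferentiableAt ℝ f (θ, t)) :
    HasDerivAt (fun s => f (θ, s)) (fderiv ℝ f (θ, t) (0, 1)) t :=
  hf.hasFDerivAt.comp_hasDerivAt t ((hasDerivAt_const t θ).prodMk (hasDerivAt_id t))

/-- Differentiation under the integral sign for a `C¹` function on the plane. -/
lemma hasDerivAt_intervalIntegral_of_contDiff {f : ℝ × ℝ → ℝ} (hf : ContDiff ℝ 1 f)
    (a b t : ℝ) :
    HasDerivAt (fun s => ∫ θ in a..b, f (θ, s))
      (∫ θ in a..b, fderiv ℝ f (θ, t) (0, 1)) t := by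
  have hf' : Continuous fun p => fderiv ℝ f p (0, 1) :=
    (hf.continuous_fderiv one_ne_zero).clm_apply continuous_const
  have hslice : ∀ s, Continuous fun θ => f (θ, s) := fun s =>
    hf.continuous.comp (by fun_prop)
  obtain ⟨C, hC⟩ := ((isCompact_uIcc (a := a) (b := b)).prod
    (isCompact_closedBall t 1)).exists_bound_of_continuousOn hf'.continuousOn
  refine (intervalIntegral.hasDerivAt_integral_of_dominated_loc_of_deriv_le
    (F := fun s θ => f (θ, s)) (F' := fun s θ => fderiv ℝ f (θ, s) (0, 1))
    (bound := fun _ => C) (Metric.closedBall_mem_nhds t one_pos)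
    (.of_forall fun s => (hslice s).aestronglyMeasurable)
    ((hslice t).intervalIntegrable a b)
    (hf'.comp (by fun_prop : Continuous fun θ : ℝ => (θ, t))).aestronglyMeasurable
    (.of_forall fun θ hθ s hs => hC (θ, s) ⟨Set.uIoc_subset_uIcc hθ, hs⟩)
    intervalIntegrable_const
    (.of_forall fun θ _ s _ => hasDerivAt_snd_slice (hf.differentiable one_ne_zero _))).2

/-- The integral over a loop of a `C¹` periodic function is conserved by transport along the loop. -/
lemma integral_eq_of_transport {f : ℝ × ℝ → ℝ} (hf : ContDiff ℝ 1 f) {T : ℝ}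
    (hper : ∀ t, f (T, t) = f (0, t)) (Ω : ℝ → ℝ)
    (htransport : ∀ θ t, fderiv ℝ f (θ, t) (0, 1) + Ω t * fderiv ℝ f (θ, t) (1, 0) = 0)
    (t₁ t₂ : ℝ) : ∫ θ in (0:ℝ)..T, f (θ, t₁) = ∫ θ in (0:ℝ)..T, f (θ, t₂) := by
  have hderiv : ∀ t, HasDerivAt (fun s => ∫ θ in (0:ℝ)..T, f (θ, s)) 0 t := by
    intro t
    have hcont : Continuous fun θ => fderiv ℝ f (θ, t) (1, 0) :=
      ((hf.continuous_fderiv one_ne_zero).comp (by fun_prop)).clm_apply continuous_const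
    have hzero : ∫ θ in (0:ℝ)..T, fderiv ℝ f (θ, t) (0, 1) = 0 := by
      calc ∫ θ in (0:ℝ)..T, fderiv ℝ f (θ, t) (0, 1)
          = ∫ θ in (0:ℝ)..T, -Ω t * fderiv ℝ f (θ, t) (1, 0) := by
            congr 1
            ext θ
            linarith [htransport θ t]
        _ = -Ω t * (f (T, t) - f (0, t)) := by
            rw [intervalIntegral.integral_const_mul,
              intervalIntegral.integral_eq_sub_of_hasDerivAt
                (fun θ _ => hasDerivAt_fst_slice (hf.differentiable one_ne_zero _))
                (hcont.intervalIntegrable 0 T)]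
        _ = 0 := by rw [hper, sub_self, mul_zero]
    exact (hasDerivAt_intervalIntegral_of_contDiff hf 0 T t).congr_deriv hzero
  exact is_const_of_deriv_eq_zero (fun t => (hderiv t).differentiableAt)
    (fun t => (hderiv t).deriv) t₁ t₂

/-- For `C¹` loop-space Lorentz dynamics with continuous magnetic field `B`
and continuous frequency `Ω`, the loop energy `t ↦ (1/2π)·∫₀^{2π} (1/2)·‖vt(θ,t)‖² dθ`
is constant in time. -/
theorem loop_energy_constant
    (ε : ℝ) (hε : ε ≠ 0)
    (B : E3 → E3) (hB : Continuous B)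
    (xt vt : ℝ → ℝ → E3)
    (hx : ContDiff ℝ 1 (fun p : ℝ × ℝ => xt p.1 p.2))
    (hv : ContDiff ℝ 1 (fun p : ℝ × ℝ => vt p.1 p.2))
    (hxper : ∀ θ t, xt (θ + 2 * π) t = xt θ t)
    (hvper : ∀ θ t, vt (θ + 2 * π) t = vt θ t)
    (Ω : ℝ → ℝ) (hΩ : Continuous Ω)
    (heq1 : ∀ θ t, deriv (fun s => xt θ s) t + Ω t • deriv (fun ϑ => xt ϑ t) θ = vt θ t)
    (heq2 : ∀ θ t, deriv (fun s => vt θ s) t + Ω t • deriv (fun ϑ => vt ϑ t) θ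
      = (1 / ε) • cross (vt θ t) (B (xt θ t))) :
    ∀ t₁ t₂ : ℝ,
      (2 * π)⁻¹ * ∫ θ in (0:ℝ)..(2 * π), (1 / 2) * ‖vt θ t₁‖ ^ 2
      = (2 * π)⁻¹ * ∫ θ in (0:ℝ)..(2 * π), (1 / 2) * ‖vt θ t₂‖ ^ 2 := by
  intro t₁ t₂
  congr 1
  have hf : ContDiff ℝ 1 fun p : ℝ × ℝ => (1 / 2) * ‖vt p.1 p.2‖ ^ 2 :=
    contDiff_const.mul (hv.norm_sq ℝ)
  refine integral_eq_of_transport hf (fun t => ?_) Ω (fun θ t => ?_) t₁ t₂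
  · have h := hvper 0 t
    rw [zero_add] at h
    simp only [h]
  · have hvd := hv.differentiable one_ne_zero (θ, t)
    have hfd := hf.differentiable one_ne_zero (θ, t)
    have hθ := hasDerivAt_fst_slice hvd
    have ht := hasDerivAt_snd_slice hvd
    rw [(hasDerivAt_fst_slice hfd).unique (hθ.norm_sq.const_mul (1 / 2)),
      (hasDerivAt_snd_slice hfd).unique (ht.norm_sq.const_mul (1 / 2)),
      ← hθ.deriv, ← ht.deriv]
    have h := congrArg (inner ℝ (vt θ t)) (heq2 θ t)
    rw [inner_add_right, inner_smul_right, inner_smul_right, inner_self_cross, mul_zero] at h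
    linear_combination h

end
end

section
/- Let B₀ ∈ ℝ³ be nonzero, b = B₀/‖B₀‖, let w ∈ ℝ³ satisfy w·b = 0, and let ū ∈ ℝ, x₀ ∈ ℝ³. Define x̃(θ,t) = x₀ + t·ū·b + (ε/‖B₀‖)·(sin θ · w − cos θ · (w × b)) and ṽ(θ,t) = ū·b + cos θ · w − sin θ · (b × w). Then the pair (x̃, ṽ) solves the loop-space Lorentz equations for the constant magnetic field B(x) = B₀ with constant frequency Ω(t) = ‖B₀‖/ε; that is, the rigid circular ring of gyroradius ε‖w‖/‖B₀‖, drifting along b at speed ū and spun at the cyclotron frequency, is an exact solution of loop-space dynamics in a uniform magnetic field. -/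
open Real

noncomputable section

lemma cross_anticomm_E3 (u v : E3) : cross u v = -cross v u := by
  ext i
  fin_cases i <;> simp [cross] <;> ring

lemma cross_smul_right (c : ℝ) (u v : E3) : cross u (c • v) = c • cross u v := by
  ext i
  fin_cases i <;> simp [cross] <;> ring

lemma cross_add_left (u v z : E3) : cross (u + v) z = cross u z + cross v z := by
  ext i
  fin_cases i <;> simp [cross] <;> ring

lemma cross_sub_left (u v z : E3) : cross (u - v) z = cross u z - cross v z := by
  ext i
  fin_cases i <;> simp [cross] <;> ring

lemma cross_smul_left (c : ℝ) (u v : E3) : cross (c • u) v = c • cross u v := by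
  ext i
  fin_cases i <;> simp [cross] <;> ring

lemma cross_self_E3 (u : E3) : cross u u = 0 := by
  ext i
  fin_cases i <;> simp [cross] <;> ring

lemma dot_self_eq_norm_sq (u : E3) : dot u u = ‖u‖ ^ 2 := by
  rw [EuclideanSpace.norm_sq_eq, Fin.sum_univ_three]
  simp [dot, sq]

lemma cross_cross_self (u v : E3) :
    cross (cross u v) u = dot u u • v - dot v u • u := by
  ext i
  fin_cases i <;> simp [cross, dot] <;> ring

/-- In a uniform magnetic field `B ≡ B₀`, the rigid circular ring of
gyroradius `ε‖w‖/‖B₀‖` drifting along `b = B₀/‖B₀‖` at speed `ubar` and spun at the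
cyclotron frequency `‖B₀‖/ε` is an exact solution of the loop-space Lorentz equations. -/
theorem rigid_ring_solves_loop_lorentz
    (ε : ℝ) (hε : ε ≠ 0)
    (B₀ : E3) (hB₀ : B₀ ≠ 0)
    (b : E3) (hb : b = ‖B₀‖⁻¹ • B₀)
    (w : E3) (hw : dot w b = 0)
    (ubar : ℝ) (x₀ : E3)
    (xt vt : ℝ → ℝ → E3)
    (hxdef : ∀ θ t, xt θ t
      = x₀ + (t * ubar) • b + (ε / ‖B₀‖) • (sin θ • w - cos θ • cross w b))
    (hvdef : ∀ θ t, vt θ t = ubar • b + cos θ • w - sin θ • cross b w) :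
    ∀ θ t,
      (deriv (fun s => xt θ s) t + (‖B₀‖ / ε) • deriv (fun ϑ => xt ϑ t) θ = vt θ t) ∧
      (deriv (fun s => vt θ s) t + (‖B₀‖ / ε) • deriv (fun ϑ => vt ϑ t) θ
        = (1 / ε) • cross (vt θ t) B₀) := by
  intro θ t
  have hn : ‖B₀‖ ≠ 0 := norm_ne_zero_iff.mpr hB₀
  have hB : B₀ = ‖B₀‖ • b := by rw [hb, smul_smul, mul_inv_cancel₀ hn, one_smul]
  have hbb : dot b b = 1 := by
    rw [dot_self_eq_norm_sq, hb, norm_smul, norm_inv, norm_norm, inv_mul_cancel₀ hn, one_pow]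
  have hxt : HasDerivAt (fun s => xt θ s) (ubar • b) t := by
    simp only [hxdef]
    simpa using ((((hasDerivAt_id t).mul_const ubar).smul_const b).const_add x₀).add_const
      ((ε / ‖B₀‖) • (sin θ • w - cos θ • cross w b))
  have hxθ : HasDerivAt (fun ϑ => xt ϑ t)
      ((ε / ‖B₀‖) • (cos θ • w - (-sin θ) • cross w b)) θ := by
    simp only [hxdef]
    exact ((((hasDerivAt_sin θ).smul_const w).sub
      ((hasDerivAt_cos θ).smul_const (cross w b))).const_smul (ε / ‖B₀‖)).const_add _
  have hvt : HasDerivAt (fun s => vt θ s) 0 t := by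
    simp only [hvdef]
    exact hasDerivAt_const t _
  have hvθ : HasDerivAt (fun ϑ => vt ϑ t) ((-sin θ) • w - cos θ • cross b w) θ := by
    simp only [hvdef]
    exact (((hasDerivAt_cos θ).smul_const w).const_add (ubar • b)).sub
      ((hasDerivAt_sin θ).smul_const (cross b w))
  rw [hxt.deriv, hxθ.deriv, hvt.deriv, hvθ.deriv, hvdef]
  constructor
  · have hΩ : ‖B₀‖ / ε * (ε / ‖B₀‖) = 1 := by field_simp
    rw [smul_smul, hΩ, cross_anticomm_E3 w b]
    module
  · have hc : cross (ubar • b + cos θ • w - sin θ • cross b w) B₀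
        = ‖B₀‖ • (cos θ • cross w b - sin θ • w) := by
      conv_lhs => rw [hB]
      rw [cross_smul_right, cross_sub_left, cross_add_left, cross_smul_left, cross_smul_left,
        cross_smul_left, cross_self_E3, cross_cross_self, hbb, hw]
      module
    rw [hc, cross_anticomm_E3 w b]
    module

end
end

section
/- Let e₁, e₂, b ∈ ℝ³ be orthonormal with e₁ × e₂ = b, and let β > 0. Define the linear map N : ℝ³ × ℝ³ × ℝ × ℝ × ℝ × ℝ → ℝ³ × ℝ³ × ℝ × ℝ × ℝ × ℝ by N(ρ⁺, ρ⁻, u⁺, u⁻, ω₁, ω₂) = ( u⁺·b + ω₁·e₁ + ω₂·e₂ − β·ρ⁻ , u⁻·b + ω₁·e₂ − ω₂·e₁ + β·ρ⁺ , −β·u⁻ , β·u⁺ , 2·β·ω₂ , −2·β·ω₁ ). Then N is a linear bijection, with inverse N⁻¹(s_ρ⁺, s_ρ⁻, s_u⁺, s_u⁻, s_ω₁, s_ω₂) = (ρ⁺, ρ⁻, u⁺, u⁻, ω₁, ω₂) given by u⁺ = s_u⁻/β, u⁻ = −s_u⁺/β, ω₁ = −s_ω₂/(2β), ω₂ = s_ω₁/(2β),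 ρ⁺ = (1/β)·s_ρ⁻ + (1/β²)·s_u⁺·b + (1/(2β²))·(s_ω₁·e₁ + s_ω₂·e₂), and ρ⁻ = −(1/β)·s_ρ⁺ + (1/β²)·s_u⁻·b + (1/(2β²))·(s_ω₁·e₂ − s_ω₂·e₁). -/
open Real

noncomputable section

/-- The first Fourier-harmonic block of the frozen-time linearized fast
dynamics of loop-space Lorentz dynamics, acting on the first-harmonic fluctuating position
coefficients, the parallel fluctuating velocity coefficients and the non-adiabatic
perpendicular velocity components, is a linear bijection with the explicit inverse stated. -/
theorem first_harmonic_block_bijective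
    (e₁ e₂ b : E3)
    (he₁ : ‖e₁‖ = 1) (he₂ : ‖e₂‖ = 1) (hb : ‖b‖ = 1)
    (h12 : dot e₁ e₂ = 0) (h1b : dot e₁ b = 0) (h2b : dot e₂ b = 0)
    (hcross : cross e₁ e₂ = b)
    (β : ℝ) (hβ : 0 < β)
    (N : E3 × E3 × ℝ × ℝ × ℝ × ℝ → E3 × E3 × ℝ × ℝ × ℝ × ℝ)
    (hN : ∀ (ρp ρm : E3) (up um ω₁ ω₂ : ℝ), N (ρp, ρm, up, um, ω₁, ω₂)
      = (up • b + ω₁ • e₁ + ω₂ • e₂ - β • ρm,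
         um • b + ω₁ • e₂ - ω₂ • e₁ + β • ρp,
         -(β * um), β * up, 2 * β * ω₂, -(2 * β * ω₁))) :
    IsLinearMap ℝ N ∧ Function.Bijective N ∧
      ∀ (sρp sρm : E3) (sup sum sω₁ sω₂ : ℝ),
        N (β⁻¹ • sρm + (sup / β ^ 2) • b + (2 * β ^ 2)⁻¹ • (sω₁ • e₁ + sω₂ • e₂),
           -(β⁻¹ • sρp) + (sum / β ^ 2) • b + (2 * β ^ 2)⁻¹ • (sω₁ • e₂ - sω₂ • e₁),
           sum / β, -(sup / β), -(sω₂ / (2 * β)), sω₁ / (2 * β))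
          = (sρp, sρm, sup, sum, sω₁, sω₂) := by
  have hβ0 : β ≠ 0 := hβ.ne'
  have hinv : ∀ (sρp sρm : E3) (sup sum sω₁ sω₂ : ℝ),
        N (β⁻¹ • sρm + (sup / β ^ 2) • b + (2 * β ^ 2)⁻¹ • (sω₁ • e₁ + sω₂ • e₂),
           -(β⁻¹ • sρp) + (sum / β ^ 2) • b + (2 * β ^ 2)⁻¹ • (sω₁ • e₂ - sω₂ • e₁),
           sum / β, -(sup / β), -(sω₂ / (2 * β)), sω₁ / (2 * β))
          = (sρp, sρm, sup, sum, sω₁, sω₂) := by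
    intro sρp sρm sup sum sω₁ sω₂
    simp only [hN, Prod.mk.injEq]
    refine ⟨?_, ?_, ?_, ?_, ?_, ?_⟩
    · match_scalars <;> field_simp <;> ring
    · match_scalars <;> field_simp <;> ring
    all_goals field_simp
  refine ⟨⟨?_, ?_⟩, ⟨?_, ?_⟩, hinv⟩
  · rintro ⟨p, m, u, v, w, z⟩ ⟨p', m', u', v', w', z'⟩
    simp only [Prod.mk_add_mk, hN, Prod.mk.injEq]
    refine ⟨?_, ?_, ?_, ?_, ?_, ?_⟩ <;> first | module | ring
  · rintro c ⟨p, m, u, v, w, z⟩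
    simp only [Prod.smul_mk, hN, Prod.mk.injEq, smul_eq_mul]
    refine ⟨?_, ?_, ?_, ?_, ?_, ?_⟩ <;> first | module | ring
  · rintro ⟨p, m, u, v, w, z⟩ ⟨p', m', u', v', w', z'⟩ h
    simp only [hN, Prod.mk.injEq] at h
    obtain ⟨hρp, hρm, hup, hum, hω₁, hω₂⟩ := h
    obtain rfl : v = v' := mul_left_cancel₀ hβ0 (neg_injective hup)
    obtain rfl : u = u' := mul_left_cancel₀ hβ0 hum
    obtain rfl : z = z' := mul_left_cancel₀ (mul_ne_zero two_ne_zero hβ0) hω₁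
    obtain rfl : w = w' := mul_left_cancel₀ (mul_ne_zero two_ne_zero hβ0) (neg_injective hω₂)
    obtain rfl : m = m' := smul_right_injective E3 hβ0 (sub_right_injective hρp)
    obtain rfl : p = p' := smul_right_injective E3 hβ0 (add_left_cancel hρm)
    rfl
  · rintro ⟨p, m, u, v, w, z⟩
    exact ⟨_, hinv p m u v w z⟩

end
end

section
/- Let X, Y be real Banach spaces, let U ⊆ ℝ be an open interval containing 0, let f : U × X × Y → Y be of class C¹, and let g : U × X × Y → X be continuous. Suppose y : U × X → Y is such that (i) for each ε ∈ U the map x ↦ y(ε,x) is differentiable with derivative D_x y(ε,x), and for each fixed x the map ε ↦ D_x y(ε,x)[g(ε, x, y(ε,x))] is continuous at ε = 0; (ii) for each x the map ε ↦ y(ε,x) is differentiable at 0, with derivative y₁(x), and write y₀(x) = y(0,x); (iii) the invariance equation ε·D_x y(ε,x)[g(ε, x, y(ε,x))] = f(ε, x, y(ε,x)) holds for all (ε,x) ∈ U × X. Then for every x ∈ X: (a) f(0, x, y₀(x)) = 0, and (b) D_y f(0, x, y₀(x))[y₁(x)] = D_x y₀(x)[g(0, x, y₀(x))] − ∂_ε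 f(0, x, y₀(x)); consequently, if D_y f(0, x, y₀(x)) is a continuous linear isomorphism of Y, then y₁(x) = (D_y f(0, x, y₀(x)))⁻¹( D_x y₀(x)[g(0, x, y₀(x))] − ∂_ε f(0, x, y₀(x)) ). (The zeroth- and first-order coefficients of a slow manifold are determined by these equations.) -/
noncomputable section

/-- Multiplying a function continuous at `0` by the variable gives a function differentiable
at `0`, with derivative the value of the original function. -/
theorem hasDerivAt_id_smul_zero_of_continuousAt {E : Type*} [NormedAddCommGroup E]
    [NormedSpace ℝ E] {h : ℝ → E} (hh : ContinuousAt h 0) :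
    HasDerivAt (fun t : ℝ => t • h t) (h 0) 0 := by
  rw [hasDerivAt_iff_tendsto_slope]
  refine (hh.tendsto.mono_left nhdsWithin_le_nhds).congr' ?_
  filter_upwards [self_mem_nhdsWithin] with t ht
  have ht0 : t ≠ 0 := ht
  simp [slope_def_module, smul_smul, ht0]

/-- For a fast–slow system `ε·ẏ = f(ε,x,y)`, `ẋ = g(ε,x,y)` on Banach
spaces, a family `x ↦ y(ε,x)` satisfying the invariance equation
`ε·D_x y(ε,x)[g(ε,x,y(ε,x))] = f(ε,x,y(ε,x))` has its zeroth- and first-order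
coefficients determined by `f(0,x,y₀(x)) = 0` and
`D_y f(0,x,y₀(x))[y₁(x)] = D_x y₀(x)[g(0,x,y₀(x))] − ∂_ε f(0,x,y₀(x))`; consequently, if
`D_y f(0,x,y₀(x))` is a continuous linear isomorphism, `y₁(x)` is given by applying its
inverse to the right-hand side. -/
theorem slow_manifold_low_order_coefficients
    {X Y : Type*} [NormedAddCommGroup X] [NormedSpace ℝ X] [CompleteSpace X]
    [NormedAddCommGroup Y] [NormedSpace ℝ Y] [CompleteSpace Y]
    (U : Set ℝ) (hUopen : IsOpen U) (hUconn : U.OrdConnected) (hU0 : (0:ℝ) ∈ U)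
    (f : ℝ → X → Y → Y) (g : ℝ → X → Y → X)
    (hf : ContDiffOn ℝ 1 (fun p : ℝ × X × Y => f p.1 p.2.1 p.2.2)
      (U ×ˢ (Set.univ : Set (X × Y))))
    (hg : ContinuousOn (fun p : ℝ × X × Y => g p.1 p.2.1 p.2.2)
      (U ×ˢ (Set.univ : Set (X × Y))))
    (y : ℝ → X → Y) (Dy : ℝ → X → X →L[ℝ] Y)
    (hDy : ∀ ε ∈ U, ∀ x : X, HasFDerivAt (y ε) (Dy ε x) x)
    (hDycont : ∀ x : X, ContinuousAt (fun ε => Dy ε x (g ε x (y ε x))) 0)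
    (y₁ : X → Y) (hy₁ : ∀ x : X, HasDerivAt (fun ε => y ε x) (y₁ x) 0)
    (hinv : ∀ ε ∈ U, ∀ x : X, ε • Dy ε x (g ε x (y ε x)) = f ε x (y ε x)) :
    ∀ x : X,
      f 0 x (y 0 x) = 0 ∧
      fderiv ℝ (f 0 x) (y 0 x) (y₁ x)
        = Dy 0 x (g 0 x (y 0 x)) - deriv (fun e => f e x (y 0 x)) 0 ∧
      ∀ T : Y ≃L[ℝ] Y, (∀ v, T v = fderiv ℝ (f 0 x) (y 0 x) v) →
        y₁ x = T.symm (Dy 0 x (g 0 x (y 0 x)) - deriv (fun e => f e x (y 0 x)) 0) := by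
  intro x
  have hU : U ∈ nhds (0 : ℝ) := hUopen.mem_nhds hU0
  have h0 : f 0 x (y 0 x) = 0 := by simpa using (hinv 0 hU0 x).symm
  have hdiff : DifferentiableAt ℝ (fun p : ℝ × X × Y => f p.1 p.2.1 p.2.2) (0, x, y 0 x) :=
    (hf.contDiffAt (prod_mem_nhds hU Filter.univ_mem)).differentiableAt one_ne_zero
  obtain ⟨F, hF⟩ := hdiff
  have hcurve : HasDerivAt (fun e => f e x (y e x)) (F (1, 0, y₁ x)) 0 :=
    hF.comp_hasDerivAt (0 : ℝ) (f := fun e => (e, x, y e x))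
      ((hasDerivAt_id (0 : ℝ)).prodMk ((hasDerivAt_const (0 : ℝ) x).prodMk (hy₁ x)))
  have heps : HasDerivAt (fun e => f e x (y 0 x)) (F (1, 0, 0)) 0 :=
    hF.comp_hasDerivAt (0 : ℝ) (f := fun e => (e, x, y 0 x))
      ((hasDerivAt_id (0 : ℝ)).prodMk
        ((hasDerivAt_const (0 : ℝ) x).prodMk (hasDerivAt_const (0 : ℝ) (y 0 x))))
  have hy : HasFDerivAt (f 0 x) (F.comp
      ((0 : Y →L[ℝ] ℝ).prod ((0 : Y →L[ℝ] X).prod (ContinuousLinearMap.id ℝ Y)))) (y 0 x) :=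
    hF.comp (y 0 x) (f := fun z : Y => ((0 : ℝ), x, z))
      ((hasFDerivAt_const (0 : ℝ) (y 0 x)).prodMk
        ((hasFDerivAt_const x (y 0 x)).prodMk (hasFDerivAt_id (y 0 x))))
  have hinv' : HasDerivAt (fun e => f e x (y e x)) (Dy 0 x (g 0 x (y 0 x))) 0 := by
    refine (hasDerivAt_id_smul_zero_of_continuousAt (hDycont x)).congr_of_eventuallyEq ?_
    filter_upwards [hU] with e he
    exact (hinv e he x).symm
  have h1 : fderiv ℝ (f 0 x) (y 0 x) (y₁ x)
      = Dy 0 x (g 0 x (y 0 x)) - deriv (fun e => f e x (y 0 x)) 0 := by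
    rw [hy.fderiv, heps.deriv, ← hcurve.unique hinv', ← map_sub]
    simp
  refine ⟨h0, h1, fun T hT => ?_⟩
  rw [← h1, ← hT, T.symm_apply_apply]

end
end

section
/- Let a, c, b ∈ ℝ³ be orthonormal with a × c = b, and let M : ℝ³ → ℝ³ be a linear map with trace M = 0. Then a × (M c) − c × (M a) = −Mᵀ b, where Mᵀ is the adjoint (transpose) of M. -/
open Real

noncomputable section

theorem linearMap_apply_eq_sum (M : E3 →ₗ[ℝ] E3) (v : E3) (i : Fin 3) :
    M v i = ∑ j, v j * M (EuclideanSpace.single j 1) i := by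
  conv_lhs => rw [← (EuclideanSpace.basisFun (Fin 3) ℝ).sum_repr v]
  simp

theorem adjoint_apply_eq_sum (M : E3 →ₗ[ℝ] E3) (v : E3) (i : Fin 3) :
    LinearMap.adjoint M v i = ∑ j, v j * M (EuclideanSpace.single i 1) j := by
  have h := LinearMap.adjoint_inner_right M (EuclideanSpace.single i 1) v
  rw [EuclideanSpace.inner_single_left] at h
  simpa [PiLp.inner_apply] using h

theorem trace_eq_sum_single (M : E3 →ₗ[ℝ] E3) :
    LinearMap.trace ℝ E3 M = ∑ i, M (EuclideanSpace.single i 1) i := by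
  rw [LinearMap.trace_eq_sum_inner M (EuclideanSpace.basisFun (Fin 3) ℝ)]
  simp [EuclideanSpace.inner_single_left]

/-- For a right-handed orthonormal frame `(a, c, b)` with `a × c = b`
and a traceless linear map `M` on `ℝ³`, `a × (M c) − c × (M a) = −Mᵀ b`. -/
theorem cross_traceless_identity
    (a c b : E3) (ha : ‖a‖ = 1) (hc : ‖c‖ = 1) (hb : ‖b‖ = 1)
    (hac : dot a c = 0) (hab : dot a b = 0) (hcb : dot c b = 0)
    (haxc : cross a c = b)
    (M : E3 →ₗ[ℝ] E3) (hM : LinearMap.trace ℝ E3 M = 0) :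
    cross a (M c) - cross c (M a) = -(LinearMap.adjoint M b) := by
  rw [trace_eq_sum_single, Fin.sum_univ_three] at hM
  subst haxc
  ext i
  simp only [PiLp.sub_apply, PiLp.neg_apply, adjoint_apply_eq_sum]
  fin_cases i <;>
    simp only [cross, WithLp.equiv_symm_apply, Fin.sum_univ_three, linearMap_apply_eq_sum M a,
      linearMap_apply_eq_sum M c, Matrix.cons_val, Fin.zero_eta, Fin.mk_one, Fin.reduceFinMk]
  · linear_combination (a 1 * c 2 - a 2 * c 1) * hM
  · linear_combination (a 2 * c 0 - a 0 * c 2) * hM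
  · linear_combination (a 0 * c 1 - a 1 * c 0) * hM

end
end

section
/- Assume the leading-order guiding-ring data, and assume in addition that the trace of the Fréchet derivative DB(x̄) is zero (e.g. B is divergence-free, as holds when B is a curl). Then (1/2π)·∫₀^{2π} ṽ₀(θ) × DB(x̄)[ρ̂₀(θ)] dθ = −(‖w‖²/(2·‖B(x̄)‖))·∇‖B‖(x̄). (The gyroaveraged Lorentz force is the mirror force.) -/
open Real

noncomputable section

@[simp] lemma cross_apply_zero (u v : E3) : cross u v 0 = u 1 * v 2 - u 2 * v 1 := rfl

@[simp] lemma cross_apply_one (u v : E3) : cross u v 1 = u 2 * v 0 - u 0 * v 2 := rfl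

@[simp] lemma cross_apply_two (u v : E3) : cross u v 2 = u 0 * v 1 - u 1 * v 0 := rfl

lemma E3.ext_coord {u v : E3} (h0 : u 0 = v 0) (h1 : u 1 = v 1) (h2 : u 2 = v 2) : u = v := by
  ext i
  fin_cases i
  exacts [h0, h1, h2]

lemma E3.inner_eq_sum (u v : E3) : inner ℝ u v = u 0 * v 0 + u 1 * v 1 + u 2 * v 2 := by
  simp [PiLp.inner_apply, Fin.sum_univ_three, mul_comm]

lemma E3.norm_sq_eq_sum (u : E3) : ‖u‖ ^ 2 = u 0 ^ 2 + u 1 ^ 2 + u 2 ^ 2 := by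
  simp [EuclideanSpace.norm_sq_eq, Fin.sum_univ_three]

/-- Coordinates of the image of a vector under a linear map of `ℝ³`. -/
lemma E3.map_apply_eq_sum (L : E3 →L[ℝ] E3) (h : E3) (i : Fin 3) :
    L h i = h 0 * L (EuclideanSpace.single 0 1) i + h 1 * L (EuclideanSpace.single 1 1) i
      + h 2 * L (EuclideanSpace.single 2 1) i := by
  have hh : h = h 0 • EuclideanSpace.single 0 (1 : ℝ) + h 1 • EuclideanSpace.single 1 (1 : ℝ)
      + h 2 • EuclideanSpace.single 2 (1 : ℝ) := by
    apply E3.ext_coord <;> simp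
  conv_lhs => rw [hh]
  simp

lemma E3.trace_eq_sum (L : E3 →L[ℝ] E3) :
    LinearMap.trace ℝ E3 L.toLinearMap = L (EuclideanSpace.single 0 1) 0
      + L (EuclideanSpace.single 1 1) 1 + L (EuclideanSpace.single 2 1) 2 := by
  rw [LinearMap.trace_eq_sum_inner _ (EuclideanSpace.basisFun (Fin 3) ℝ)]
  simp [Fin.sum_univ_three, EuclideanSpace.inner_single_left]

/-- The infinitesimal form of the cofactor identity `Lᵀ (L a × L c) = det L • (a × c)`. -/
lemma cross_map_sub_cross_map (L : E3 →L[ℝ] E3) (a c : E3) :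
    cross a (L c) - cross c (L a) = LinearMap.trace ℝ E3 L.toLinearMap • cross a c
      - ContinuousLinearMap.adjoint L (cross a c) := by
  have hadj (v : E3) (i : Fin 3) : ContinuousLinearMap.adjoint L v i
      = inner ℝ v (L (EuclideanSpace.single i 1)) := by
    rw [← ContinuousLinearMap.adjoint_inner_left]
    simp [EuclideanSpace.inner_single_right]
  rw [E3.trace_eq_sum]
  apply E3.ext_coord <;>
    simp only [PiLp.sub_apply, PiLp.smul_apply, smul_eq_mul, hadj, E3.inner_eq_sum,
      cross_apply_zero, cross_apply_one, cross_apply_two, E3.map_apply_eq_sum L a,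
      E3.map_apply_eq_sum L c] <;>
    ring

lemma cross_cross_self_of_dot_eq_zero {w b : E3} (h : dot w b = 0) :
    cross (cross w b) w = ‖w‖ ^ 2 • b := by
  rw [dot] at h
  rw [E3.norm_sq_eq_sum]
  apply E3.ext_coord <;>
    simp only [PiLp.smul_apply, smul_eq_mul, cross_apply_zero, cross_apply_one, cross_apply_two]
  · linear_combination (-w 0) * h
  · linear_combination (-w 1) * h
  · linear_combination (-w 2) * h

lemma gradient_norm_comp {B : E3 → E3} {x : E3} (hB : DifferentiableAt ℝ B x) (hx : B x ≠ 0) :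
    gradient (fun y => ‖B y‖) x
      = ContinuousLinearMap.adjoint (fderiv ℝ B x) (‖B x‖⁻¹ • B x) := by
  apply HasGradientAt.gradient
  rw [hasGradientAt_iff_hasFDerivAt]
  have hsq : HasFDerivAt (fun y => √(‖B y‖ ^ 2)) _ x :=
    (hB.hasFDerivAt.norm_sq).sqrt (by positivity)
  simp only [Real.sqrt_sq (norm_nonneg _)] at hsq
  refine hsq.congr_fderiv ?_
  ext h
  have : ‖B x‖ ≠ 0 := norm_ne_zero_iff.mpr hx
  simp [ContinuousLinearMap.adjoint_inner_left]
  field_simp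

/-- The integral over a period of a quadratic trigonometric polynomial with vector coefficients. -/
lemma integral_trig_quadratic {E : Type*} [NormedAddCommGroup E] [NormedSpace ℝ E]
    [CompleteSpace E] (p q r s t : E) :
    ∫ θ in (0 : ℝ)..(2 * π), (sin θ • p + cos θ • q + (sin θ * cos θ) • r
      + sin θ ^ 2 • s + cos θ ^ 2 • t) = π • (s + t) := by
  have hi (f : ℝ → ℝ) (hf : Continuous f) (v : E) :
      IntervalIntegrable (fun θ => f θ • v) MeasureTheory.volume 0 (2 * π) :=
    (hf.smul continuous_const).intervalIntegrable _ _
  have h1 := hi (fun θ => sin θ) (by fun_prop) p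
  have h2 := hi (fun θ => cos θ) (by fun_prop) q
  have h3 := hi (fun θ => sin θ * cos θ) (by fun_prop) r
  have h4 := hi (fun θ => sin θ ^ 2) (by fun_prop) s
  have h5 := hi (fun θ => cos θ ^ 2) (by fun_prop) t
  rw [intervalIntegral.integral_add (((h1.add h2).add h3).add h4) h5,
    intervalIntegral.integral_add ((h1.add h2).add h3) h4,
    intervalIntegral.integral_add (h1.add h2) h3, intervalIntegral.integral_add h1 h2]
  simp only [intervalIntegral.integral_smul_const, integral_sin, integral_cos,
    integral_sin_mul_cos₁, integral_sin_sq, integral_cos_sq]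
  simp

/-- (Gyroaveraged Lorentz force is the mirror force.) For the
leading-order guiding-ring data with `trace DB(x̄) = 0`,
`(1/2π)·∫₀^{2π} v₀(θ) × DB(x̄)[ρ₀(θ)] dθ = −(‖w‖²/(2‖B(x̄)‖))·∇‖B‖(x̄)`. -/
theorem gyroaveraged_lorentz_force
    (B : E3 → E3) (hB : ContDiff ℝ 1 B)
    (xbar : E3) (hBx : B xbar ≠ 0)
    (b : E3) (hbdef : b = ‖B xbar‖⁻¹ • B xbar)
    (w : E3) (hw : dot w b = 0) (ubar : ℝ)
    (ρ₀ v₀ : ℝ → E3)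
    (hρ₀ : ∀ θ, ρ₀ θ = ‖B xbar‖⁻¹ • (sin θ • w - cos θ • cross w b))
    (hv₀ : ∀ θ, v₀ θ = ubar • b + cos θ • w - sin θ • cross b w)
    (htr : LinearMap.trace ℝ E3 (fderiv ℝ B xbar).toLinearMap = 0) :
    (2 * π)⁻¹ • (∫ θ in (0:ℝ)..(2 * π), cross (v₀ θ) (fderiv ℝ B xbar (ρ₀ θ)))
      = -((‖w‖ ^ 2 / (2 * ‖B xbar‖)) • gradient (fun y => ‖B y‖) xbar) := by
  set L := fderiv ℝ B xbar
  set n := ‖B xbar‖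
  set m := cross w b with hm
  have hv (θ : ℝ) : cross (v₀ θ) (L (ρ₀ θ))
      = sin θ • ((n⁻¹ * ubar) • cross b (L w)) + cos θ • (-((n⁻¹ * ubar) • cross b (L m)))
        + (sin θ * cos θ) • (n⁻¹ • (cross w (L w) - cross m (L m)))
        + sin θ ^ 2 • (n⁻¹ • cross m (L w)) + cos θ ^ 2 • (-(n⁻¹ • cross w (L m))) := by
    rw [hρ₀, hv₀, map_smul, map_sub, map_smul, map_smul]
    apply E3.ext_coord <;> simp [hm] <;> ring
  have hgrad : gradient (fun y => ‖B y‖) xbar = ContinuousLinearMap.adjoint L b := by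
    rw [hbdef]
    exact gradient_norm_comp (hB.differentiable one_ne_zero xbar) hBx
  have hst : n⁻¹ • cross m (L w) + -(n⁻¹ • cross w (L m))
      = -((n⁻¹ * ‖w‖ ^ 2) • ContinuousLinearMap.adjoint L b) := by
    rw [← sub_eq_add_neg, ← smul_sub, cross_map_sub_cross_map, htr,
      cross_cross_self_of_dot_eq_zero hw, map_smul, zero_smul, zero_sub, smul_neg, smul_smul]
  simp only [hv]
  rw [integral_trig_quadratic, hst, hgrad, smul_neg, smul_neg, smul_smul, smul_smul]
  congr 2
  field_simp

end
end

section
/- Assume the leading-order guiding-ring data. Then (1/2π)·∫₀^{2π} cos θ · ( ṽ₀(θ) × DB(x̄)[ρ̂₀(θ)] ) dθ = −(ū/(2·‖B(x̄)‖))·( b × DB(x̄)[w × b] ). -/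
open Real

noncomputable section

/-- Integrating a vector-valued trigonometric polynomial, whose monomials are those of the
`cos`-weighted force on a ring, over one period leaves only the `cos ^ 2` term. -/
theorem integral_cos_weighted_trig (a b c d e : E3) :
    ∫ θ in (0:ℝ)..(2 * π), ((sin θ * cos θ) • a + (cos θ ^ 2) • b + (sin θ * cos θ ^ 2) • c
      + (cos θ ^ 3) • d + (sin θ ^ 2 * cos θ) • e) = π • b := by
  have integrable {f : ℝ → E3} (hf : Continuous f) :
      IntervalIntegrable f MeasureTheory.volume 0 (2 * π) := hf.intervalIntegrable _ _
  rw [intervalIntegral.integral_add (integrable (by fun_prop)) (integrable (by fun_prop)),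
    intervalIntegral.integral_add (integrable (by fun_prop)) (integrable (by fun_prop)),
    intervalIntegral.integral_add (integrable (by fun_prop)) (integrable (by fun_prop)),
    intervalIntegral.integral_add (integrable (by fun_prop)) (integrable (by fun_prop))]
  simp only [intervalIntegral.integral_smul_const, integral_sin_mul_cos₁, integral_cos_sq,
    integral_sin_mul_cos_sq, integral_cos_pow_three, integral_sin_sq_mul_cos]
  simp

/-- For the leading-order guiding-ring data,
`(1/2π)·∫₀^{2π} cos θ·(v₀(θ) × DB(x̄)[ρ₀(θ)]) dθ = −(ū/(2‖B(x̄)‖))·(b × DB(x̄)[w × b])`. -/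
theorem gyroaverage_cos_weighted
    (B : E3 → E3) (hB : ContDiff ℝ 1 B)
    (xbar : E3) (hBx : B xbar ≠ 0)
    (b : E3) (hbdef : b = ‖B xbar‖⁻¹ • B xbar)
    (w : E3) (hw : dot w b = 0) (ubar : ℝ)
    (ρ₀ v₀ : ℝ → E3)
    (hρ₀ : ∀ θ, ρ₀ θ = ‖B xbar‖⁻¹ • (sin θ • w - cos θ • cross w b))
    (hv₀ : ∀ θ, v₀ θ = ubar • b + cos θ • w - sin θ • cross b w)
    :
    (2 * π)⁻¹ • (∫ θ in (0:ℝ)..(2 * π), cos θ • cross (v₀ θ) (fderiv ℝ B xbar (ρ₀ θ)))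
      = -((ubar / (2 * ‖B xbar‖)) • cross b (fderiv ℝ B xbar (cross w b))) := by
  set L := fderiv ℝ B xbar
  set m := ‖B xbar‖⁻¹ with hm
  have expand (θ : ℝ) : cos θ • cross (v₀ θ) (L (ρ₀ θ)) =
      (sin θ * cos θ) • ((ubar * m) • cross b (L w))
      + (cos θ ^ 2) • (-(ubar * m) • cross b (L (cross w b)))
      + (sin θ * cos θ ^ 2) • (m • (cross w (L w) + cross (cross b w) (L (cross w b))))
      + (cos θ ^ 3) • (-m • cross w (L (cross w b)))
      + (sin θ ^ 2 * cos θ) • (-m • cross (cross b w) (L w)) := by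
    rw [hρ₀, hv₀, map_smul, map_sub, map_smul, map_smul]
    generalize L (cross w b) = q
    generalize L w = p
    generalize cross b w = n
    ext i
    fin_cases i <;> simp [cross] <;> ring
  simp only [expand]
  rw [integral_cos_weighted_trig, smul_smul, smul_smul, ← neg_smul]
  congr 1
  rw [hm]
  have hnorm : ‖B xbar‖ ≠ 0 := norm_ne_zero_iff.mpr hBx
  field_simp

end
end

section
/- Assume the leading-order guiding-ring data. Then (1/2π)·∫₀^{2π} sin θ · ( ṽ₀(θ) × DB(x̄)[ρ̂₀(θ)] ) dθ = (ū/(2·‖B(x̄)‖))·( b × DB(x̄)[w] ). -/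
open Real

noncomputable section

/-- Expansion of the integrand into trigonometric monomials. -/
lemma sin_smul_cross_expand (u r s c : ℝ) (b w p q : E3) :
    s • cross (u • b + c • w - s • cross b w) (r • (s • p - c • q)) =
      (s ^ 2) • ((u * r) • cross b p) - (s * c) • ((u * r) • cross b q)
        + (s ^ 2 * c) • (r • (cross w p + cross (cross b w) q))
        - (s * c ^ 2) • (r • cross w q) - (s ^ 3) • (r • cross (cross b w) p) := by
  ext i
  fin_cases i <;> simp [cross] <;> ring

lemma integral_sin_mul_cos_period : ∫ θ in (0:ℝ)..(2 * π), sin θ * cos θ = 0 := by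
  simp [integral_sin_mul_cos₁]

lemma integral_sin_sq_period : ∫ θ in (0:ℝ)..(2 * π), sin θ ^ 2 = π := by
  simp [integral_sin_sq]

lemma integral_sin_sq_mul_cos_period : ∫ θ in (0:ℝ)..(2 * π), sin θ ^ 2 * cos θ = 0 := by
  simp

lemma integral_sin_mul_cos_sq_period : ∫ θ in (0:ℝ)..(2 * π), sin θ * cos θ ^ 2 = 0 := by
  simp

lemma integral_sin_cube_period : ∫ θ in (0:ℝ)..(2 * π), sin θ ^ 3 = 0 := by
  simp [integral_sin_pow_three]

/-- For the leading-order guiding-ring data,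
`(1/2π)·∫₀^{2π} sin θ·(v₀(θ) × DB(x̄)[ρ₀(θ)]) dθ = (ū/(2‖B(x̄)‖))·(b × DB(x̄)[w])`. -/
theorem gyroaverage_sin_weighted
    (B : E3 → E3) (hB : ContDiff ℝ 1 B)
    (xbar : E3) (hBx : B xbar ≠ 0)
    (b : E3) (hbdef : b = ‖B xbar‖⁻¹ • B xbar)
    (w : E3) (hw : dot w b = 0) (ubar : ℝ)
    (ρ₀ v₀ : ℝ → E3)
    (hρ₀ : ∀ θ, ρ₀ θ = ‖B xbar‖⁻¹ • (sin θ • w - cos θ • cross w b))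
    (hv₀ : ∀ θ, v₀ θ = ubar • b + cos θ • w - sin θ • cross b w)
    :
    (2 * π)⁻¹ • (∫ θ in (0:ℝ)..(2 * π), sin θ • cross (v₀ θ) (fderiv ℝ B xbar (ρ₀ θ)))
      = (ubar / (2 * ‖B xbar‖)) • cross b (fderiv ℝ B xbar w) := by
  have integrable : ∀ (f : ℝ → ℝ) (x : E3), Continuous f →
      IntervalIntegrable (fun θ => f θ • x) MeasureTheory.volume 0 (2 * π) :=
    fun f x hf => (hf.smul continuous_const).intervalIntegrable _ _
  have h₁ := fun x => integrable (fun θ => sin θ ^ 2) x (by fun_prop)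
  have h₂ := fun x => integrable (fun θ => sin θ * cos θ) x (by fun_prop)
  have h₃ := fun x => integrable (fun θ => sin θ ^ 2 * cos θ) x (by fun_prop)
  have h₄ := fun x => integrable (fun θ => sin θ * cos θ ^ 2) x (by fun_prop)
  have h₅ := fun x => integrable (fun θ => sin θ ^ 3) x (by fun_prop)
  simp_rw [hv₀, hρ₀, map_smul, map_sub, map_smul, sin_smul_cross_expand]
  rw [intervalIntegral.integral_sub ((((h₁ _).sub (h₂ _)).add (h₃ _)).sub (h₄ _)) (h₅ _),
    intervalIntegral.integral_sub (((h₁ _).sub (h₂ _)).add (h₃ _)) (h₄ _),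
    intervalIntegral.integral_add ((h₁ _).sub (h₂ _)) (h₃ _),
    intervalIntegral.integral_sub (h₁ _) (h₂ _)]
  simp only [intervalIntegral.integral_smul_const, integral_sin_sq_period,
    integral_sin_mul_cos_period, integral_sin_sq_mul_cos_period,
    integral_sin_mul_cos_sq_period, integral_sin_cube_period, zero_smul, sub_zero, add_zero]
  rw [smul_smul, smul_smul]
  congr 1
  have := norm_ne_zero_iff.mpr hBx
  field_simp

end
end

section
/- Every solution (x̄, ū, w₁, w₂) : I → ℝ³ × ℝ × ℝ × ℝ of the leading-order guiding center system conserves the leading-order adiabatic invariant: t ↦ (w₁(t)² + w₂(t)²)/(2·‖B(x̄(t))‖) is constant on I. -/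
open Real

noncomputable section

/-- The derivative of a scalar field along a curve whose velocity is `c • v`. -/
theorem HasDerivAt.comp_of_velocity_smul {f : E3 → ℝ} {γ : ℝ → E3} {c t : ℝ} {v : E3}
    (hf : DifferentiableAt ℝ f (γ t)) (hγ : HasDerivAt γ (c • v) t) :
    HasDerivAt (fun s => f (γ s)) (c * dot (gradient f (γ t)) v) t := by
  have h := hf.hasGradientAt.hasFDerivAt.comp_hasDerivAt t hγ
  simpa [dot_eq_inner, Function.comp_def, InnerProductSpace.toDual_apply_apply] using h

/-- Every solution of the leading-order guiding center system conserves
the leading-order adiabatic invariant `(w₁² + w₂²)/(2‖B(x̄)‖)`. -/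
theorem leading_order_adiabatic_invariant
    (B : E3 → E3) (hB : ContDiff ℝ 1 B) (hBne : ∀ x, B x ≠ 0)
    (b : E3 → E3) (hbdef : ∀ x, b x = ‖B x‖⁻¹ • B x)
    (e₁ e₂ : E3 → E3) (he₁ : ContDiff ℝ 1 e₁) (he₂ : ContDiff ℝ 1 e₂)
    (hframe : ∀ x, ‖e₁ x‖ = 1 ∧ ‖e₂ x‖ = 1 ∧ dot (e₁ x) (e₂ x) = 0 ∧
      dot (e₁ x) (b x) = 0 ∧ dot (e₂ x) (b x) = 0 ∧ cross (e₁ x) (e₂ x) = b x)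
    (τ κpar ϱ : E3 → ℝ)
    (hτ : ∀ x, τ x = dot (b x) (curl b x))
    (hκ : ∀ x, κpar x = dot (gradient (fun y => ‖B y‖) x) (b x) / ‖B x‖)
    (hϱ : ∀ x, ϱ x = dot (fderiv ℝ e₁ x (b x)) (e₂ x))
    (I : Set ℝ) (hI : Convex ℝ I)
    (xbar : ℝ → E3) (ubar w₁ w₂ : ℝ → ℝ)
    (hxbar : ∀ t ∈ I, HasDerivAt xbar (ubar t • b (xbar t)) t)
    (hubar : ∀ t ∈ I, HasDerivAt ubar
      (-((w₁ t ^ 2 + w₂ t ^ 2) / (2 * ‖B (xbar t)‖)) *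
        dot (gradient (fun y => ‖B y‖) (xbar t)) (b (xbar t))) t)
    (hw₁ : ∀ t ∈ I, HasDerivAt w₁
      (ubar t * ϱ (xbar t) * w₂ t + (1 / 2) * ubar t * κpar (xbar t) * w₁ t
        + (1 / 2) * ubar t * τ (xbar t) * w₂ t) t)
    (hw₂ : ∀ t ∈ I, HasDerivAt w₂
      (-(ubar t * ϱ (xbar t) * w₁ t) - (1 / 2) * ubar t * τ (xbar t) * w₁ t
        + (1 / 2) * ubar t * κpar (xbar t) * w₂ t) t)
    :
    ∀ t₁ ∈ I, ∀ t₂ ∈ I,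
      (w₁ t₁ ^ 2 + w₂ t₁ ^ 2) / (2 * ‖B (xbar t₁)‖)
        = (w₁ t₂ ^ 2 + w₂ t₂ ^ 2) / (2 * ‖B (xbar t₂)‖) := by
  have hderiv : ∀ t ∈ I,
      HasDerivAt (fun t => (w₁ t ^ 2 + w₂ t ^ 2) / (2 * ‖B (xbar t)‖)) 0 t := by
    intro t ht
    have hpos : ‖B (xbar t)‖ ≠ 0 := norm_ne_zero_iff.mpr (hBne _)
    have hnorm : DifferentiableAt ℝ (fun y => ‖B y‖) (xbar t) :=
      ((hB.differentiable one_ne_zero) (xbar t)).norm ℝ (hBne _)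
    have hm := HasDerivAt.comp_of_velocity_smul hnorm (hxbar t ht)
    refine ((((hw₁ t ht).pow 2).add ((hw₂ t ht).pow 2)).div (hm.const_mul 2)
      (mul_ne_zero two_ne_zero hpos)).congr_deriv ?_
    simp only [hκ, Pi.add_apply, Pi.pow_apply, Nat.cast_ofNat]
    field_simp
    ring
  intro t₁ h₁ t₂ h₂
  have h := hI.norm_image_sub_le_of_norm_hasDerivWithin_le (C := 0)
    (fun t ht => (hderiv t ht).hasDerivWithinAt) (by simp) h₂ h₁
  simpa [sub_eq_zero] using h

end
end

section
/- Every solution (x̄, ū, w₁, w₂) : I → ℝ³ × ℝ × ℝ × ℝ of the leading-order guiding center system conserves the energy: t ↦ (1/2)·ū(t)² + (1/2)·(w₁(t)² + w₂(t)²) is constant on I. -/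
open Real

noncomputable section

/-- Every solution of the leading-order guiding center system conserves
the energy `(1/2)·ū² + (1/2)·(w₁² + w₂²)`. -/
theorem leading_order_energy_conservation
    (B : E3 → E3) (hB : ContDiff ℝ 1 B) (hBne : ∀ x, B x ≠ 0)
    (b : E3 → E3) (hbdef : ∀ x, b x = ‖B x‖⁻¹ • B x)
    (e₁ e₂ : E3 → E3) (he₁ : ContDiff ℝ 1 e₁) (he₂ : ContDiff ℝ 1 e₂)
    (hframe : ∀ x, ‖e₁ x‖ = 1 ∧ ‖e₂ x‖ = 1 ∧ dot (e₁ x) (e₂ x) = 0 ∧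
      dot (e₁ x) (b x) = 0 ∧ dot (e₂ x) (b x) = 0 ∧ cross (e₁ x) (e₂ x) = b x)
    (τ κpar ϱ : E3 → ℝ)
    (hτ : ∀ x, τ x = dot (b x) (curl b x))
    (hκ : ∀ x, κpar x = dot (gradient (fun y => ‖B y‖) x) (b x) / ‖B x‖)
    (hϱ : ∀ x, ϱ x = dot (fderiv ℝ e₁ x (b x)) (e₂ x))
    (I : Set ℝ) (hI : Convex ℝ I)
    (xbar : ℝ → E3) (ubar w₁ w₂ : ℝ → ℝ)
    (hxbar : ∀ t ∈ I, HasDerivAt xbar (ubar t • b (xbar t)) t)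
    (hubar : ∀ t ∈ I, HasDerivAt ubar
      (-((w₁ t ^ 2 + w₂ t ^ 2) / (2 * ‖B (xbar t)‖)) *
        dot (gradient (fun y => ‖B y‖) (xbar t)) (b (xbar t))) t)
    (hw₁ : ∀ t ∈ I, HasDerivAt w₁
      (ubar t * ϱ (xbar t) * w₂ t + (1 / 2) * ubar t * κpar (xbar t) * w₁ t
        + (1 / 2) * ubar t * τ (xbar t) * w₂ t) t)
    (hw₂ : ∀ t ∈ I, HasDerivAt w₂
      (-(ubar t * ϱ (xbar t) * w₁ t) - (1 / 2) * ubar t * τ (xbar t) * w₁ t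
        + (1 / 2) * ubar t * κpar (xbar t) * w₂ t) t)
    :
    ∀ t₁ ∈ I, ∀ t₂ ∈ I,
      (1 / 2) * ubar t₁ ^ 2 + (1 / 2) * (w₁ t₁ ^ 2 + w₂ t₁ ^ 2)
        = (1 / 2) * ubar t₂ ^ 2 + (1 / 2) * (w₁ t₂ ^ 2 + w₂ t₂ ^ 2) := by
  intro t₁ h₁ t₂ h₂
  have hderiv : ∀ t ∈ I, HasDerivWithinAt
      (fun s => (1 / 2) * ubar s ^ 2 + (1 / 2) * (w₁ s ^ 2 + w₂ s ^ 2)) 0 I t := by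
    intro t ht
    have hE := (((hubar t ht).pow 2).const_mul (1 / 2)).add
      ((((hw₁ t ht).pow 2).add ((hw₂ t ht).pow 2)).const_mul (1 / 2))
    refine (hE.congr_deriv ?_).hasDerivWithinAt
    have hne : ‖B (xbar t)‖ ≠ 0 := norm_ne_zero_iff.mpr (hBne _)
    rw [hκ]
    field_simp
    ring
  have hbound := hI.norm_image_sub_le_of_norm_hasDerivWithin_le (C := 0) hderiv
    (fun _ _ => norm_zero.le) h₂ h₁
  rw [zero_mul] at hbound
  exact sub_eq_zero.mp (norm_le_zero_iff.mp hbound)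

end
end
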